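/- arXiv:1504.08064 — 3 statements merged into one kernel-verified Lean document; each statement's English description precedes it below -/
import Mathlib

section
/- Let R be a commutative ring that is also a ℚ-algebra, d : R → R a derivation, η ∈ R, and γ ∈ R an element with d(d(γ)) = 0. Set B := d(γ), assume B is nilpotent, and define u := γ · Σ_{n≥0} Bⁿ/(n+1)! ∈ R and exp(B) := Σ_{n≥0} Bⁿ/n! (finite sums since B is nilpotent). Then for every ω ∈ R with d(ω) − η·ω = 0 one has exp(B)·ω − ω = d(u·ω) − η·(u·ω). In particular, for every cocycle ω of the twisted operator D(ω) = d(ω) − η·ω, the elements exp(B)·ω and ω differ by an element of the image of D. -/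
/-- The exponential `exp B = ∑_{n≥0} Bⁿ/n!` of a nilpotent element `B` (with `B ^ N = 0`),
truncated at `N`; for nilpotent `B` this finite sum is the full exponential. -/
noncomputable def expNil {R : Type*} [Ring R] [Algebra ℚ R] (B : R) (N : ℕ) : R :=
  ∑ n ∈ Finset.range N, (n.factorial : ℚ)⁻¹ • B ^ n

/-- The element `u = γ · ∑_{n≥0} Bⁿ/(n+1)!` (with `B = d γ` nilpotent, `B ^ N = 0`),
truncated at `N`; for nilpotent `B` this finite sum is the full series
`γ · (exp B - 1)/B`. -/
noncomputable def expHomotopy {R : Type*} [Ring R] [Algebra ℚ R] (γ B : R) (N : ℕ) : R :=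
  γ * ∑ n ∈ Finset.range N, ((n + 1).factorial : ℚ)⁻¹ • B ^ n

/-- Let `R` be a commutative ring that is also a `ℚ`-algebra, `d : R → R` a
derivation, `η ∈ R`, and `γ ∈ R` with `d (d γ) = 0`. Set `B := d γ`, assume `B` nilpotent
(say `B ^ N = 0`), and let `u := γ · ∑_{n≥0} Bⁿ/(n+1)!`. Then for every `ω` with
`d ω - η · ω = 0` one has `exp B · ω - ω = d (u · ω) - η · (u · ω)`; in particular `exp B · ω`
and `ω` differ by an element of the image of the twisted operator `D ω = d ω - η ω`. -/
theorem exp_coboundary_homotopy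
    {R : Type*} [CommRing R] [Algebra ℚ R]
    (d : Derivation ℚ R R) (η γ : R) (N : ℕ)
    (hdd : d (d γ) = 0) (hB : (d γ) ^ N = 0) :
    ∀ ω : R, d ω - η * ω = 0 →
      expNil (d γ) N * ω - ω
        = d (expHomotopy γ (d γ) N * ω) - η * (expHomotopy γ (d γ) N * ω) := by
  intro ω hω
  have hS : d (∑ n ∈ Finset.range N, ((n + 1).factorial : ℚ)⁻¹ • (d γ) ^ n) = 0 := by
    rw [map_sum]
    refine Finset.sum_eq_zero fun n _ => ?_
    rw [Derivation.map_smul, Derivation.leibniz_pow, hdd]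
    simp
  have hE : d γ * ∑ n ∈ Finset.range N, ((n + 1).factorial : ℚ)⁻¹ • (d γ) ^ n
      = expNil (d γ) N - 1 := by
    have h1 := Finset.sum_range_succ (fun n => ((n.factorial : ℚ)⁻¹ • (d γ) ^ n)) N
    have h2 := Finset.sum_range_succ' (fun n => ((n.factorial : ℚ)⁻¹ • (d γ) ^ n)) N
    rw [h1, hB] at h2
    simp only [smul_zero, add_zero, Nat.factorial_zero, Nat.cast_one, inv_one, pow_zero,
      one_smul] at h2
    rw [expNil, h2, add_sub_cancel_right, Finset.mul_sum]
    refine Finset.sum_congr rfl fun n _ => ?_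
    rw [mul_smul_comm, pow_succ']
  unfold expHomotopy
  generalize (∑ n ∈ Finset.range N, ((n + 1).factorial : ℚ)⁻¹ • (d γ) ^ n) = S at hS hE ⊢
  rw [Derivation.leibniz, Derivation.leibniz, hS]
  simp only [smul_eq_mul]
  linear_combination (-ω) * hE - γ * S * hω
end

section
/- Let A be a unital associative ℂ-algebra, (Ω, d) a differential graded algebra over ℂ, (Ω̄, d̄) a cochain complex of ℂ-vector spaces, Tr : Ω → Ω̄ a graded trace, and ρ : A → Ω⁰ a unital ℂ-algebra homomorphism. Define τ_k : A^{⊗(k+1)} → Ω̄ᵏ on elementary tensors by τ_k(a₀⊗⋯⊗a_k) = (1/k!)·Tr(ρ(a₀)·d(ρ(a₁))⋯d(ρ(a_k))). Then for every k ≥ 1 and every c ∈ A^{⊗(k+1)} one has τ_{k−1}(b(c)) = 0, and for every k ≥ 0 and every c ∈ A^{⊗(k+1)} one has τ_{k+1}(B(c)) = d̄(τ_k(c)). Consequently τ = (τ_k)_{k≥0} is a chain map from the ℤ/2-graded periodic cyclic complex (PC_•(A), b + B), where PC_i(A) = ⊕_{k ≡ i (mod 2)} A^{⊗(k+1)}, to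 the 2-periodization of (Ω̄, d̄). -/
/-- The Connes–HKR trace map `τ_k(a₀ ⊗ ⋯ ⊗ a_k) = (1/k!)·Tr(ρ(a₀)·d(ρ(a₁))⋯d(ρ(a_k)))`,
written on an elementary tensor, i.e. on a `(k+1)`-tuple of elements of `A`. -/
noncomputable def tauMap {A : Type*} [Ring A] [Algebra ℂ A]
    {Ω : Type*} [Ring Ω] [Algebra ℂ Ω]
    {Ωb : Type*} [AddCommGroup Ωb] [Module ℂ Ωb]
    (d : Ω →ₗ[ℂ] Ω) (Tr : Ω →ₗ[ℂ] Ωb) (ρ : A →ₐ[ℂ] Ω)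
    (k : ℕ) (a : Fin (k + 1) → A) : Ωb :=
  (k.factorial : ℂ)⁻¹ • Tr (ρ (a 0) * (List.ofFn fun i : Fin k => d (ρ (a i.succ))).prod)

/-- The `i`-th Hochschild face (`0 ≤ i ≤ k`) of a `(k+2)`-tuple:
`a₀ ⊗ ⋯ ⊗ (a_i·a_{i+1}) ⊗ ⋯ ⊗ a_{k+1}`. -/
def hochFace {A : Type*} [Mul A] {k : ℕ} (i : ℕ) (a : Fin (k + 2) → A) :
    Fin (k + 1) → A := fun j =>
  if (j : ℕ) < i then a j.castSucc
  else if (j : ℕ) = i then a j.castSucc * a j.succ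
  else a j.succ

/-- The last Hochschild face of a `(k+2)`-tuple:
`(a_{k+1}·a₀) ⊗ a₁ ⊗ ⋯ ⊗ a_k`. -/
def hochFaceLast {A : Type*} [Mul A] {k : ℕ} (a : Fin (k + 2) → A) :
    Fin (k + 1) → A := fun j =>
  if (j : ℕ) = 0 then a (Fin.last (k + 1)) * a 0 else a j.castSucc

/-- The `i`-th term (`0 ≤ i ≤ k`) of the Connes coboundary of a `(k+1)`-tuple:
`1 ⊗ a_{k-i+1} ⊗ ⋯ ⊗ a_k ⊗ a₀ ⊗ ⋯ ⊗ a_{k-i}`; the entry at position `j ≥ 1` is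
`a_{(k - i + j) mod (k+1)}`. -/
def connesTerm {A : Type*} [One A] {k : ℕ} (i : ℕ) (a : Fin (k + 1) → A) :
    Fin (k + 2) → A := fun j =>
  if (j : ℕ) = 0 then 1
  else a ⟨(k - i + (j : ℕ)) % (k + 1), Nat.mod_lt _ k.succ_pos⟩

/-- Ordered product `f s * f (s+1) * ⋯ * f (s+n-1)`. -/
def consecProd {R : Type*} [Monoid R] (f : ℕ → R) (s : ℕ) : ℕ → R
  | 0 => 1
  | n + 1 => consecProd f s n * f (s + n)

theorem consecProd_congr {R : Type*} [Monoid R] (f g : ℕ → R) (s t n : ℕ)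
    (h : ∀ j, j < n → f (s + j) = g (t + j)) : consecProd f s n = consecProd g t n := by
  induction n with
  | zero => rfl
  | succ n ih =>
    simp only [consecProd]
    rw [ih (fun j hj => h j (by omega)), h n (by omega)]

theorem consecProd_add {R : Type*} [Monoid R] (f : ℕ → R) (s m n : ℕ) :
    consecProd f s (m + n) = consecProd f s m * consecProd f (s + m) n := by
  induction n with
  | zero => simp [consecProd]
  | succ n ih =>
    rw [← Nat.add_assoc]
    simp only [consecProd]
    rw [ih, mul_assoc, Nat.add_assoc]

theorem consecProd_one {R : Type*} [Monoid R] (f : ℕ → R) (s : ℕ) :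
    consecProd f s 1 = f s := by simp [consecProd]

theorem ofFn_prod_eq {R : Type*} [Monoid R] (n : ℕ) (g : Fin n → R) (f : ℕ → R) (s : ℕ)
    (h : ∀ i : Fin n, g i = f (s + i)) : (List.ofFn g).prod = consecProd f s n := by
  induction n with
  | zero => simp [consecProd]
  | succ n ih =>
    rw [List.ofFn_succ', List.concat_eq_append, List.prod_append, List.prod_singleton,
      ih (fun i => g i.castSucc) (fun i => by rw [h]; rfl), h]
    rfl

/-- Let `A` be a unital associative `ℂ`-algebra, `(Ω, d)` a differential
graded algebra over `ℂ`, `(Ω̄, d̄)` a cochain complex of `ℂ`-vector spaces, `Tr : Ω → Ω̄` a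
graded trace, and `ρ : A → Ω⁰` a unital `ℂ`-algebra homomorphism. Then, with
`τ_k(a₀⊗⋯⊗a_k) = (1/k!)·Tr(ρ(a₀)·d(ρ(a₁))⋯d(ρ(a_k)))`, for every `k ≥ 1` and every
elementary tensor one has `τ_{k-1}(b(c)) = 0`, and for every `k ≥ 0` one has
`τ_{k+1}(B(c)) = d̄(τ_k(c))`; hence `τ` is a chain map from the periodic cyclic complex
`(PC_•(A), b + B)` to the 2-periodization of `(Ω̄, d̄)`. (Here the first conjunct is stated
for tuples of length `k + 2`, i.e. for the cyclic degree `k + 1 ≥ 1`.) -/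
theorem tau_is_chain_map
    {A : Type*} [Ring A] [Algebra ℂ A]
    {Ω : Type*} [Ring Ω] [Algebra ℂ Ω]
    (𝒜 : ℕ → Submodule ℂ Ω) [GradedAlgebra 𝒜]
    (d : Ω →ₗ[ℂ] Ω)
    (hddeg : ∀ (n : ℕ) (x : Ω), x ∈ 𝒜 n → d x ∈ 𝒜 (n + 1))
    (hd2 : ∀ x : Ω, d (d x) = 0)
    (hdleib : ∀ (n : ℕ) (x : Ω), x ∈ 𝒜 n → ∀ y : Ω,
      d (x * y) = d x * y + ((-1 : ℂ) ^ n) • (x * d y))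
    {Ωb : Type*} [AddCommGroup Ωb] [Module ℂ Ωb]
    (ℬ : ℕ → Submodule ℂ Ωb) (hℬ : DirectSum.IsInternal ℬ)
    (db : Ωb →ₗ[ℂ] Ωb)
    (hdbdeg : ∀ (n : ℕ) (x : Ωb), x ∈ ℬ n → db x ∈ ℬ (n + 1))
    (hdb2 : ∀ x : Ωb, db (db x) = 0)
    (Tr : Ω →ₗ[ℂ] Ωb)
    (hTrdeg : ∀ (n : ℕ) (x : Ω), x ∈ 𝒜 n → Tr x ∈ ℬ n)
    (hTrd : ∀ x : Ω, Tr (d x) = db (Tr x))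
    (hTrace : ∀ (m n : ℕ) (x y : Ω), x ∈ 𝒜 m → y ∈ 𝒜 n →
      Tr (x * y) = ((-1 : ℂ) ^ (m * n)) • Tr (y * x))
    (ρ : A →ₐ[ℂ] Ω) (hρ : ∀ a : A, ρ a ∈ 𝒜 0) :
    (∀ (k : ℕ) (a : Fin (k + 2) → A),
        (∑ i ∈ Finset.range (k + 1),
            ((-1 : ℂ) ^ i) • tauMap d Tr ρ k (hochFace i a))
          + ((-1 : ℂ) ^ (k + 1)) • tauMap d Tr ρ k (hochFaceLast a) = 0) ∧
    (∀ (k : ℕ) (a : Fin (k + 1) → A),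
        ∑ i ∈ Finset.range (k + 1),
            ((-1 : ℂ) ^ (k * i)) • tauMap d Tr ρ (k + 1) (connesTerm i a)
          = db (tauMap d Tr ρ k a)) := by
  have hc0 : ∀ x : Ω, x ∈ 𝒜 0 → ∀ y : Ω, d (x * y) = d x * y + x * d y := by
    intro x hx y
    simpa using hdleib 0 x hx y
  have hPmem : ∀ (f : ℕ → A) (s n : ℕ),
      consecProd (fun j => d (ρ (f j))) s n ∈ 𝒜 n := by
    intro f s n
    induction n with
    | zero => exact SetLike.GradedOne.one_mem
    | succ n ih =>
      exact SetLike.GradedMul.mul_mem ih (by simpa using hddeg 0 _ (hρ (f (s + n))))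
  have hd1 : d 1 = 0 := by
    have := hc0 1 SetLike.GradedOne.one_mem 1
    simpa using this
  have hPd : ∀ (f : ℕ → A) (s n : ℕ),
      d (consecProd (fun j => d (ρ (f j))) s n) = 0 := by
    intro f s n
    induction n with
    | zero => exact hd1
    | succ n ih =>
      simp only [consecProd]
      rw [hdleib n _ (hPmem f s n), ih, hd2]
      simp
  have htau : ∀ (k : ℕ) (a : Fin (k + 1) → A) (f : ℕ → A) (_ : ∀ i : Fin (k + 1), a i = f i),
      tauMap d Tr ρ k a = (k.factorial : ℂ)⁻¹ •
        Tr (ρ (f 0) * consecProd (fun j => d (ρ (f j))) 1 k) := by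
    intro k a f h
    unfold tauMap
    rw [ofFn_prod_eq k _ (fun j => d (ρ (f j))) 1 (fun i => by
      rw [h]; simp [Nat.add_comm]), h 0]
    simp
  constructor
  · intro k a
    obtain ⟨f, hf⟩ : ∃ f : ℕ → A, ∀ i : Fin (k + 2), a i = f i :=
      ⟨fun j => a (Fin.ofNat (k + 2) j), fun i => by simp⟩
    set P : ℕ → ℕ → Ω := consecProd (fun j => d (ρ (f j))) with hP
    -- telescoping terms
    set T : ℕ → Ω := fun i => ρ (f 0) * P 1 i * ρ (f (i + 1)) * P (i + 2) (k - i) with hT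
    have hface : ∀ i, i < k + 1 → tauMap d Tr ρ k (hochFace i a) = (k.factorial : ℂ)⁻¹ •
        Tr (T i + if i = 0 then 0 else T (i - 1)) := by
      intro i hi
      rw [htau k _ (fun j => if j < i then f j else if j = i then f j * f (j + 1) else f (j + 1))
        (fun j => by simp [hochFace, hf])]
      congr 2
      rcases i with _ | m
      · simp only [hT, hP]
        simp only [lt_irrefl, if_false, if_true, consecProd, map_mul, mul_one, Nat.sub_zero,
          add_zero]
        congr 1
        apply consecProd_congr
        intro j hj
        have h1 : ¬ (1 + j < 0) := by omega
        have h2 : ¬ (1 + j = 0) := by omega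
        have h3 : 1 + j + 1 = 0 + 2 + j := by omega
        simp only [h1, h2, if_false, h3]
      · obtain ⟨r, rfl⟩ : ∃ r, k = m + (1 + r) := ⟨k - m - 1, by omega⟩
        have e1 : m + (1 + r) - (m + 1) = r := by omega
        have e2 : m + (1 + r) - m = 1 + r := by omega
        simp only [hT, Nat.add_sub_cancel, e1, e2, Nat.succ_ne_zero, if_false]
        rw [consecProd_add, consecProd_add, consecProd_one]
        rw [hP, consecProd_congr _ (fun j => d (ρ (f j))) 1 1 m, 
          consecProd_congr _ (fun j => d (ρ (f j))) (1 + m + 1) (m + 1 + 2) r,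
          consecProd_add _ (m + 2), consecProd_add _ 1 m 1, consecProd_one, consecProd_one]
        · have h1 : ¬ (1 + m < m + 1) := by omega
          have h2 : 1 + m = m + 1 := by omega
          have h3 : m + 2 + 1 = m + 1 + 2 := by omega
          simp only [h2, lt_irrefl, if_false, if_true, map_mul, h3, Nat.succ_pos]
          rw [hc0 _ (hρ _)]
          noncomm_ring
        · intro j hj
          have h1 : ¬ (1 + m + 1 + j < m + 1) := by omega
          have h2 : ¬ (1 + m + 1 + j = m + 1) := by omega
          have h3 : 1 + m + 1 + j + 1 = m + 1 + 2 + j := by omega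
          simp only [h1, h2, if_false, h3]
        · intro j hj
          have h1 : 1 + j < m + 1 := by omega
          simp only [h1, if_true]
    have hsum : ∀ n, n < k + 1 → ∑ i ∈ Finset.range (n + 1),
        ((-1 : ℂ) ^ i) • tauMap d Tr ρ k (hochFace i a) =
          ((-1 : ℂ) ^ n) • (k.factorial : ℂ)⁻¹ • Tr (T n) := by
      intro n
      induction n with
      | zero => intro h; simp [hface 0 h]
      | succ n ih =>
        intro h
        rw [Finset.sum_range_succ, ih (by omega), hface _ h]
        simp only [Nat.succ_ne_zero, if_false, Nat.add_sub_cancel, map_add, smul_add, pow_succ]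
        module
    rw [hsum k (by omega), htau k _ (fun j => if j = 0 then f (k + 1) * f 0 else f j)
        (fun j => by simp [hochFaceLast, hf])]
    have e : Tr (T k) = Tr (ρ (f (k + 1) * f 0) * P 1 k) := by
      simp only [hT, Nat.sub_self]
      have := hTrace k 0 (ρ (f 0) * P 1 k) (ρ (f (k + 1))) (by
        simpa using SetLike.GradedMul.mul_mem (hρ (f 0)) (hPmem f 1 k)) (hρ _)
      simpa [hP, consecProd, mul_assoc] using this
    rw [e, consecProd_congr _ (fun j => d (ρ (f j))) 1 1 k (fun j _ => by simp)]
    simp only [if_true, ← hP, pow_succ]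
    module
  · intro k a
    set f : ℕ → A := fun j => a (Fin.ofNat (k + 1) j) with hfdef
    have hf : ∀ i : Fin (k + 1), a i = f i := fun i => by simp [hfdef]
    have hper : ∀ j, f (k + 1 + j) = f j := by
      intro j
      simp only [hfdef]
      congr 1
      apply Fin.ext
      simp [Fin.ofNat]
    have hterm : ∀ i ∈ Finset.range (k + 1),
        ((-1 : ℂ) ^ (k * i)) • tauMap d Tr ρ (k + 1) (connesTerm i a) =
        ((k + 1).factorial : ℂ)⁻¹ • Tr (consecProd (fun j => d (ρ (f j))) 0 (k + 1)) := by
      intro i hi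
      rw [Finset.mem_range] at hi
      obtain ⟨r, rfl⟩ : ∃ r, k = r + i := ⟨k - i, by omega⟩
      rw [htau _ _ (fun j => if j = 0 then 1 else f (r + j)) (fun j => by
        simp [connesTerm, hfdef, Fin.ofNat])]
      rw [consecProd_congr _ (fun j => d (ρ (f j))) 1 (r + 1) (r + i + 1) (fun j _ => by
        simp [Nat.add_assoc])]
      have e1 : r + i + 1 = i + (r + 1) := by omega
      have e2 : r + i + 1 = (r + 1) + i := by omega
      have h1 := consecProd_add (fun j => d (ρ (f j))) (r + 1) i (r + 1)
      have h2 := consecProd_add (fun j => d (ρ (f j))) 0 (r + 1) i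
      rw [← e1] at h1
      rw [← e2, Nat.zero_add] at h2
      have h3 : consecProd (fun j => d (ρ (f j))) (r + 1 + i) (r + 1) =
          consecProd (fun j => d (ρ (f j))) 0 (r + 1) :=
        consecProd_congr _ _ _ _ _ (fun j _ => by
          rw [← e2, hper, Nat.zero_add])
      rw [h1, h2, h3]
      simp only [if_true, map_one, one_mul]
      rw [hTrace i (r + 1) _ _ (hPmem f _ _) (hPmem f _ _)]
      rw [smul_comm, smul_smul ((-1 : ℂ) ^ ((r + i) * i)), ← pow_add]
      have : Even ((r + i) * i + i * (r + 1)) := by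
        have : (r + i) * i + i * (r + 1) = 2 * (r * i) + i * (i + 1) := by ring
        rw [this]
        exact (even_two_mul _).add (Nat.even_mul_succ_self i)
      rw [this.neg_one_pow, one_smul]
    rw [Finset.sum_congr rfl hterm, htau k a f hf, Finset.sum_const, Finset.card_range,
      map_smul, ← hTrd, hc0 _ (hρ _), hPd, mul_zero, add_zero, Nat.add_comm k 1,
      consecProd_add, consecProd_one, ← Nat.cast_smul_eq_nsmul ℂ, smul_smul]
    congr 1
    rw [Nat.add_comm 1 k, Nat.factorial_succ]
    have h1 : ((k + 1 : ℕ) : ℂ) ≠ 0 := Nat.cast_ne_zero.mpr (by omega)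
    have h2 : ((k.factorial : ℕ) : ℂ) ≠ 0 := Nat.cast_ne_zero.mpr k.factorial_ne_zero
    push_cast at h1 ⊢
    field_simp
end

section
/- Let Ω = ⊕_{n≥0} Ωⁿ be an ℕ-graded unital associative ℚ-algebra. Let Θ ∈ Ω² be nilpotent, let ∇ be a graded derivation of degree +1 satisfying ∇²(x) = Θx − xΘ for all x ∈ Ω, and let ι be a graded derivation of degree −1. Assume that ∇(Θ) and ι(Θ) are graded-central in Ω. Extend ∇ and ι to Ω[t] := Ω ⊗_ℚ ℚ[t] by ℚ[t]-linearity, and set e^{tΘ} := Σ_{n≥0} tⁿΘⁿ/n! ∈ Ω[t] (a finite sum since Θ is nilpotent). Let β(t) ∈ Ω⁰ ⊗_ℚ ℚ[t] satisfy (d/dt)β(t) = −(∇ι + ι∇)(β(t)). Then in Ω[t]: −(d/dt)(e^{−tΘ}·β(t)·e^{tΘ}) = (∇ + ι)(e^{−tΘ}·∇(β(t))·e^{tΘ}). -/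
/-- The polynomial `e^{tΘ} = ∑_{n≥0} tⁿΘⁿ/n! ∈ Ω[t]` of a nilpotent element `Θ`
(with `Θ ^ N = 0`), truncated at `N`; for nilpotent `Θ` this finite sum is the full
exponential. -/
noncomputable def expPolyNil {Ω : Type*} [Ring Ω] [Algebra ℚ Ω] (Θ : Ω) (N : ℕ) :
    Polynomial Ω :=
  ∑ n ∈ Finset.range N, (n.factorial : ℚ)⁻¹ • (Polynomial.C Θ * Polynomial.X) ^ n

open Polynomial in
theorem aux_coeff_exp {Ω : Type*} [Ring Ω] [Algebra ℚ Ω] (Θ : Ω) (N : ℕ) (hN : Θ ^ N = 0) (n : ℕ) :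
    (expPolyNil Θ N).coeff n = (n.factorial : ℚ)⁻¹ • Θ ^ n := by
  have h : ∀ k : ℕ, (C Θ * X : Polynomial Ω) ^ k = C (Θ ^ k) * X ^ k := fun k => by
    rw [(commute_X (C Θ)).symm.mul_pow, C_pow]
  unfold expPolyNil
  simp only [h, finsetSum_coeff, coeff_smul, coeff_C_mul_X_pow]
  simp only [smul_ite, smul_zero, Finset.sum_ite_eq, Finset.mem_range]
  split_ifs with hn
  · rfl
  · rw [pow_eq_zero_of_le (not_lt.mp hn) hN, smul_zero]

theorem aux_fact (n : ℕ) : ((n+1).factorial : ℚ)⁻¹ * (n+1) = (n.factorial : ℚ)⁻¹ := by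
  have : (n.factorial : ℚ) ≠ 0 := by positivity
  rw [Nat.factorial_succ]; push_cast; field_simp

open Polynomial in
theorem aux_deriv_exp {Ω : Type*} [Ring Ω] [Algebra ℚ Ω] (Θ : Ω) (N : ℕ) (hN : Θ ^ N = 0) :
    derivative (expPolyNil Θ N) = C Θ * expPolyNil Θ N := by
  ext n
  rw [coeff_derivative, coeff_C_mul, aux_coeff_exp Θ N hN, aux_coeff_exp Θ N hN, ← aux_fact n,
    mul_smul_comm, ← pow_succ', mul_smul, smul_mul_assoc]
  congr 1
  rw [Algebra.smul_def, Algebra.commutes]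
  simp

open Polynomial in
theorem aux_comm_exp {Ω : Type*} [Ring Ω] [Algebra ℚ Ω] (Θ a : Ω) (N : ℕ) (hN : Θ ^ N = 0)
    (h : a * Θ = Θ * a) : C a * expPolyNil Θ N = expPolyNil Θ N * C a := by
  ext n
  have h2 : Commute a (Θ ^ n) := Commute.pow_right h n
  rw [coeff_C_mul, coeff_mul_C, aux_coeff_exp Θ N hN, mul_smul_comm, smul_mul_assoc, h2.eq]

open Polynomial in
theorem aux_coeff_map {Ω : Type*} [Ring Ω] [Algebra ℚ Ω] (δ : Ω →ₗ[ℚ] Ω)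
    (δ' : Polynomial Ω →ₗ[ℚ] Polynomial Ω)
    (hδ' : ∀ (c : Ω) (n : ℕ), δ' (C c * X ^ n) = C (δ c) * X ^ n) (p : Polynomial Ω) (n : ℕ) :
    (δ' p).coeff n = δ (p.coeff n) := by
  induction p using Polynomial.induction_on' with
  | add p q hp hq => simp [hp, hq]
  | monomial k a =>
    rw [← C_mul_X_pow_eq_monomial, hδ', coeff_C_mul_X_pow, coeff_C_mul_X_pow]
    split_ifs <;> simp

open Polynomial in
theorem aux_leib {Ω : Type*} [Ring Ω] [Algebra ℚ Ω] (𝒜 : ℕ → Submodule ℚ Ω) (δ : Ω →ₗ[ℚ] Ω)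
    (hleib : ∀ (n : ℕ) (x : Ω), x ∈ 𝒜 n → ∀ y : Ω,
      δ (x * y) = δ x * y + ((-1 : ℚ) ^ n) • (x * δ y))
    (δ' : Polynomial Ω →ₗ[ℚ] Polynomial Ω)
    (hδ' : ∀ (c : Ω) (n : ℕ), δ' (C c * X ^ n) = C (δ c) * X ^ n)
    (k : ℕ) (p q : Polynomial Ω) (hp : ∀ m, p.coeff m ∈ 𝒜 k) :
    δ' (p * q) = δ' p * q + ((-1 : ℚ) ^ k) • (p * δ' q) := by
  ext n
  rw [aux_coeff_map δ δ' hδ', coeff_add, coeff_smul, coeff_mul, coeff_mul, coeff_mul, map_sum,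
    Finset.smul_sum, ← Finset.sum_add_distrib]
  refine Finset.sum_congr rfl fun x _ => ?_
  rw [hleib k _ (hp _), aux_coeff_map δ δ' hδ', aux_coeff_map δ δ' hδ']

open Polynomial in
theorem aux_map_exp {Ω : Type*} [Ring Ω] [Algebra ℚ Ω] (𝒜 : ℕ → Submodule ℚ Ω) [GradedAlgebra 𝒜]
    (δ : Ω →ₗ[ℚ] Ω)
    (hleib : ∀ (n : ℕ) (x : Ω), x ∈ 𝒜 n → ∀ y : Ω,
      δ (x * y) = δ x * y + ((-1 : ℚ) ^ n) • (x * δ y))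
    (δ' : Polynomial Ω →ₗ[ℚ] Polynomial Ω)
    (hδ' : ∀ (c : Ω) (n : ℕ), δ' (C c * X ^ n) = C (δ c) * X ^ n)
    (Θ : Ω) (hΘ : Θ ∈ 𝒜 2) (N : ℕ) (hN : Θ ^ N = 0) (hc : δ Θ * Θ = Θ * δ Θ) :
    δ' (expPolyNil Θ N) = C (δ Θ) * expPolyNil Θ N * X := by
  have h1 : δ 1 = 0 := by
    have := hleib 0 1 SetLike.GradedOne.one_mem 1
    simpa using this
  have hp : ∀ n : ℕ, δ (Θ ^ (n+1)) = ((n : ℚ) + 1) • (δ Θ * Θ ^ n) := by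
    intro n
    induction n with
    | zero => simp
    | succ n ih =>
      have h2 : Θ * (δ Θ * Θ ^ n) = δ Θ * Θ ^ (n+1) := by
        rw [← mul_assoc, ← hc, mul_assoc, ← pow_succ']
      rw [pow_succ', hleib 2 Θ hΘ, ih, mul_smul_comm, h2]
      push_cast
      module
  ext n
  rw [aux_coeff_map δ δ' hδ', aux_coeff_exp Θ N hN, map_smul]
  cases n with
  | zero => simp [h1]
  | succ n =>
    rw [coeff_mul_X, coeff_C_mul, aux_coeff_exp Θ N hN, hp, ← aux_fact n, mul_smul, mul_smul_comm,
      mul_smul_comm]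

open Polynomial in
theorem aux_key {Ω : Type*} [Ring Ω] [Algebra ℚ Ω] (𝒜 : ℕ → Submodule ℚ Ω) [GradedAlgebra 𝒜]
    (δ : Ω →ₗ[ℚ] Ω)
    (hleib : ∀ (n : ℕ) (x : Ω), x ∈ 𝒜 n → ∀ y : Ω,
      δ (x * y) = δ x * y + ((-1 : ℚ) ^ n) • (x * δ y))
    (δ' : Polynomial Ω →ₗ[ℚ] Polynomial Ω)
    (hδ' : ∀ (c : Ω) (n : ℕ), δ' (C c * X ^ n) = C (δ c) * X ^ n)
    (Θ : Ω) (hΘ : Θ ∈ 𝒜 2) (N : ℕ) (hN : Θ ^ N = 0) (hc : δ Θ * Θ = Θ * δ Θ)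
    (hc1 : ∀ x ∈ 𝒜 1, δ Θ * x = - (x * δ Θ)) (B : Polynomial Ω) (hB : ∀ m, B.coeff m ∈ 𝒜 1) :
    δ' (expPolyNil (-Θ) N * B * expPolyNil Θ N)
      = expPolyNil (-Θ) N * δ' B * expPolyNil Θ N := by
  have hN' : (-Θ) ^ N = 0 := by rw [neg_pow, hN, mul_zero]
  have hE := aux_map_exp 𝒜 δ hleib δ' hδ' Θ hΘ N hN hc
  have hF := aux_map_exp 𝒜 δ hleib δ' hδ' (-Θ) (neg_mem hΘ) N hN' (by simp [hc])
  have hcF := aux_comm_exp (-Θ) (δ Θ) N hN' (by simp [hc])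
  have hBc : B * C (δ Θ) = - (C (δ Θ) * B) := by
    ext m
    rw [coeff_neg, coeff_C_mul, coeff_mul_C, hc1 _ (hB m), neg_neg]
  -- the exponential is a sum of even-degree parts
  have hFl : ∀ q : Polynomial Ω, δ' (expPolyNil (-Θ) N * q)
      = δ' (expPolyNil (-Θ) N) * q + expPolyNil (-Θ) N * δ' q := by
    intro q
    ext n
    rw [aux_coeff_map δ δ' hδ', coeff_add, coeff_mul, coeff_mul, coeff_mul, map_sum,
      ← Finset.sum_add_distrib]
    refine Finset.sum_congr rfl fun x _ => ?_
    rw [aux_coeff_map δ δ' hδ', aux_coeff_map δ δ' hδ']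
    have hm : (expPolyNil (-Θ) N).coeff x.1 ∈ 𝒜 (x.1 • 2) := by
      rw [aux_coeff_exp _ N hN']
      exact Submodule.smul_mem _ _ (SetLike.pow_mem_graded _ (neg_mem hΘ))
    rw [hleib _ _ hm]
    simp
  rw [mul_assoc, hFl, aux_leib 𝒜 δ hleib δ' hδ' 1 B _ hB, hE, hF]
  generalize expPolyNil (-Θ) N = F at *
  generalize expPolyNil Θ N = E at *
  have e1 : B * (C (δ Θ) * E * X) = - (C (δ Θ) * B * E * X) := by
    rw [← mul_assoc, ← mul_assoc, hBc]; simp [mul_assoc]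
  have e2 : F * (C (δ Θ) * B * E * X) = C (δ Θ) * F * B * E * X := by
    rw [hcF]; simp [mul_assoc]
  have e3 : C (δ (-Θ)) * F * X * (B * E) = - (C (δ Θ) * F * B * E * X) := by
    rw [map_neg, C_neg, mul_assoc _ X, X_mul]
    simp [mul_assoc]
  rw [e1, e3, pow_one, smul_neg, neg_smul, one_smul, neg_neg, mul_add, e2, ← mul_assoc F (δ' B) E]
  abel

/-- Let `Ω` be an `ℕ`-graded unital associative `ℚ`-algebra, `Θ ∈ Ω²`
nilpotent, `∇` a graded derivation of degree `+1` with `∇² = [Θ, ·]`, `ι` a graded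
derivation of degree `-1`, and suppose `∇Θ` and `ιΘ` are graded-central. Extend `∇` and
`ι` to `Ω[t]` by `ℚ[t]`-linearity (the maps `∇'`, `ι'` below, characterized on monomials
`C c * Xⁿ`), and let `β(t) ∈ Ω⁰[t]` satisfy `β'(t) = -(∇ι + ι∇)(β(t))`. Then
`-(d/dt)(e^{-tΘ}·β(t)·e^{tΘ}) = (∇ + ι)(e^{-tΘ}·∇(β(t))·e^{tΘ})` in `Ω[t]`. -/
theorem curved_dga_exp_conjugation_identity
    {Ω : Type*} [Ring Ω] [Algebra ℚ Ω]
    (𝒜 : ℕ → Submodule ℚ Ω) [GradedAlgebra 𝒜]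
    (Θ : Ω) (hΘ : Θ ∈ 𝒜 2) (N : ℕ) (hN : Θ ^ N = 0)
    (Dd ci : Ω →ₗ[ℚ] Ω)
    (hDdeg : ∀ (n : ℕ) (x : Ω), x ∈ 𝒜 n → Dd x ∈ 𝒜 (n + 1))
    (hcideg : ∀ (n : ℕ) (x : Ω), x ∈ 𝒜 (n + 1) → ci x ∈ 𝒜 n)
    (hci0 : ∀ x : Ω, x ∈ 𝒜 0 → ci x = 0)
    (hDleib : ∀ (n : ℕ) (x : Ω), x ∈ 𝒜 n → ∀ y : Ω,
      Dd (x * y) = Dd x * y + ((-1 : ℚ) ^ n) • (x * Dd y))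
    (hcileib : ∀ (n : ℕ) (x : Ω), x ∈ 𝒜 n → ∀ y : Ω,
      ci (x * y) = ci x * y + ((-1 : ℚ) ^ n) • (x * ci y))
    (hD2 : ∀ x : Ω, Dd (Dd x) = Θ * x - x * Θ)
    (hDΘcentral : ∀ (n : ℕ) (x : Ω), x ∈ 𝒜 n →
      Dd Θ * x = ((-1 : ℚ) ^ (3 * n)) • (x * Dd Θ))
    (hciΘcentral : ∀ (n : ℕ) (x : Ω), x ∈ 𝒜 n →
      ci Θ * x = ((-1 : ℚ) ^ n) • (x * ci Θ))
    (D' ci' : Polynomial Ω →ₗ[ℚ] Polynomial Ω)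
    (hD' : ∀ (c : Ω) (n : ℕ),
      D' (Polynomial.C c * Polynomial.X ^ n) = Polynomial.C (Dd c) * Polynomial.X ^ n)
    (hci' : ∀ (c : Ω) (n : ℕ),
      ci' (Polynomial.C c * Polynomial.X ^ n) = Polynomial.C (ci c) * Polynomial.X ^ n)
    (β : Polynomial Ω) (hβ : ∀ m : ℕ, β.coeff m ∈ 𝒜 0)
    (hβ' : Polynomial.derivative β = -(D' (ci' β) + ci' (D' β))) :
    -Polynomial.derivative (expPolyNil (-Θ) N * β * expPolyNil Θ N)
      = D' (expPolyNil (-Θ) N * D' β * expPolyNil Θ N)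
        + ci' (expPolyNil (-Θ) N * D' β * expPolyNil Θ N) := by
  have hN' : (-Θ) ^ N = 0 := by rw [neg_pow, hN, mul_zero]
  have hB : ∀ m, (D' β).coeff m ∈ 𝒜 1 := fun m => by
    rw [aux_coeff_map Dd D' hD']; exact hDdeg 0 _ (hβ m)
  rw [aux_key 𝒜 Dd hDleib D' hD' Θ hΘ N hN (by rw [hDΘcentral 2 Θ hΘ]; norm_num)
      (fun x hx => by rw [hDΘcentral 1 x hx]; norm_num [pow_succ]) _ hB,
    aux_key 𝒜 ci hcileib ci' hci' Θ hΘ N hN (by simpa using hciΘcentral 2 Θ hΘ)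
      (fun x hx => by rw [hciΘcentral 1 x hx]; norm_num) _ hB]
  have h0 : ci' β = 0 := by
    ext m
    rw [aux_coeff_map ci ci' hci', hci0 _ (hβ m), Polynomial.coeff_zero]
  have hDD : D' (D' β) = Polynomial.C Θ * β - β * Polynomial.C Θ := by
    ext m
    rw [aux_coeff_map Dd D' hD', aux_coeff_map Dd D' hD', hD2, Polynomial.coeff_sub,
      Polynomial.coeff_C_mul, Polynomial.coeff_mul_C]
  rw [h0, map_zero, zero_add] at hβ'
  have hcomm := aux_comm_exp (-Θ) Θ N hN' (by simp)
  rw [Polynomial.derivative_mul, Polynomial.derivative_mul, aux_deriv_exp Θ N hN,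
    aux_deriv_exp (-Θ) N hN', hβ', hDD, Polynomial.C_neg, neg_mul, hcomm]
  noncomm_ring
end
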